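/- For every i with 1 ≤ i ≤ k and every j with 2 ≤ j ≤ r_i, one has B_{i,j} = (B_{i,2})^{j−1}, i.e., B_{i,j} equals the (j−1)-st matrix power of B_{i,2}. -/

import Mathlib

open Matrix Polynomial

theorem pf_unique {n k : ℕ} (lam : Fin k → ℂ) (hlam : Function.Injective lam) (r : Fin k → ℕ)
    (M : Fin k → ℕ → Matrix (Fin n) (Fin n) ℂ) (D : Matrix (Fin n) (Fin n) ℂ)
    (h : ∀ s : ℂ, (∀ i, s ≠ lam i) →
      ∑ i, ∑ j ∈ Finset.Icc 1 (r i), ((s - lam i) ^ j)⁻¹ • M i j = D) :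
    (∀ i, ∀ j ∈ Finset.Icc 1 (r i), M i j = 0) ∧ D = 0 := by
  have key : ∀ i, ∀ j ∈ Finset.Icc 1 (r i), M i j = 0 := by
    intro i
    by_contra! hne
    obtain ⟨j0, hj0, hj0'⟩ := hne
    obtain ⟨m, hm, hmax⟩ := Finset.exists_max_image
      ((Finset.Icc 1 (r i)).filter (fun j => M i j ≠ 0)) id
      ⟨j0, by simp only [Finset.mem_filter]; exact ⟨hj0, hj0'⟩⟩
    simp only [Finset.mem_filter, id] at hm hmax
    have hz : ∀ j ∈ Finset.Icc 1 (r i), m < j → M i j = 0 := by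
      intro j hj hmj
      by_contra hc
      exact absurd (hmax j ⟨hj, hc⟩) (by omega)
    have hm1 : 1 ≤ m := (Finset.mem_Icc.1 hm.1).1
    let F : ℂ → Matrix (Fin n) (Fin n) ℂ := fun s =>
      ∑ j ∈ Finset.Icc 1 (r i), (s - lam i) ^ (m - j) • M i j
    let G : ℂ → Matrix (Fin n) (Fin n) ℂ := fun s =>
      (s - lam i) ^ m • (D - ∑ l ∈ Finset.univ.erase i, ∑ j ∈ Finset.Icc 1 (r l),
        ((s - lam l) ^ j)⁻¹ • M l j)
    have hF : ContinuousAt F (lam i) := by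
      apply Continuous.continuousAt
      fun_prop
    have hG : ContinuousAt G (lam i) := by
      have hc : ContinuousAt (fun s : ℂ => (s - lam i) ^ m) (lam i) := by fun_prop
      refine ContinuousAt.smul hc (ContinuousAt.sub continuousAt_const ?_)
      refine tendsto_finsetSum _ fun l hl => tendsto_finsetSum _ fun j hj => ?_
      have hc' : ContinuousAt (fun s : ℂ => (s - lam l) ^ j) (lam i) := by fun_prop
      refine ContinuousAt.smul (ContinuousAt.inv₀ hc' ?_) continuousAt_const
      apply pow_ne_zero
      rw [sub_ne_zero]
      exact fun e => (Finset.ne_of_mem_erase hl) (hlam e).symm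
    have hev : ∀ᶠ s in nhdsWithin (lam i) {lam i}ᶜ, F s = G s := by
      have h1 : ∀ᶠ s in nhdsWithin (lam i) {lam i}ᶜ, ∀ l, s ≠ lam l := by
        rw [Filter.eventually_all]
        intro l
        by_cases hl : l = i
        · subst hl
          exact eventually_mem_nhdsWithin
        · apply eventually_nhdsWithin_of_eventually_nhds
          exact isOpen_ne.mem_nhds (fun e => hl (hlam e).symm)
      filter_upwards [h1] with s hs
      have hx : s - lam i ≠ 0 := sub_ne_zero.2 (hs i)
      have h2 := h s hs
      rw [← Finset.add_sum_erase _ _ (Finset.mem_univ i)] at h2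
      simp only [F, G]
      rw [← h2, add_sub_cancel_right, Finset.smul_sum]
      refine Finset.sum_congr rfl fun j hj => ?_
      by_cases hmj : m < j
      · simp [hz j hj hmj]
      · rw [smul_smul, pow_sub₀ _ hx (by omega)]
    have hFG : F (lam i) = G (lam i) :=
      tendsto_nhds_unique_of_eventuallyEq (hF.tendsto.mono_left nhdsWithin_le_nhds)
        (hG.tendsto.mono_left nhdsWithin_le_nhds) hev
    have hG0 : G (lam i) = 0 := by
      simp [G, zero_pow (show m ≠ 0 by omega)]
    have hF0 : F (lam i) = M i m := by
      simp only [F]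
      rw [Finset.sum_eq_single m]
      · simp
      · intro j hj hjm
        by_cases hmj : m < j
        · simp [hz j hj hmj]
        · rw [sub_self, zero_pow (by omega), zero_smul]
      · exact fun hc => absurd hm.1 hc
    exact hm.2 (by rw [← hF0, hFG, hG0])
  refine ⟨key, ?_⟩
  obtain ⟨s, hs⟩ := Set.Finite.exists_notMem (Set.finite_range lam)
  rw [← h s (fun i e => hs ⟨i, e.symm⟩)]
  exact Finset.sum_eq_zero fun i _ => Finset.sum_eq_zero fun j hj => by rw [key i j hj, smul_zero]

theorem shift_sum {E : Type*} [AddCommGroup E] (f : ℕ → E) (r : ℕ) :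
    ∑ j ∈ Finset.Icc 1 r, f (j - 1) = f 0 + ∑ j ∈ Finset.Icc 1 r, f j - f r := by
  induction r with
  | zero => simp
  | succ r ih =>
    rw [Finset.sum_Icc_succ_top (by omega), Finset.sum_Icc_succ_top (by omega), ih]
    simp only [Nat.add_sub_cancel]
    abel

/-- One-sided coefficient comparison; `T c` stands for multiplication by `A - c` on one side. -/
theorem coeff_rec {n k : ℕ} (lam : Fin k → ℂ) (hlam : Function.Injective lam) (r : Fin k → ℕ)
    (B : Fin k → ℕ → Matrix (Fin n) (Fin n) ℂ) (hB0 : ∀ i j, r i < j → B i j = 0)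
    (T : Matrix (Fin n) (Fin n) ℂ →ₗ[ℂ] Matrix (Fin n) (Fin n) ℂ)
    (hT : ∀ s : ℂ, (∀ i, s ≠ lam i) →
      (s • (LinearMap.id : Matrix (Fin n) (Fin n) ℂ →ₗ[ℂ] Matrix (Fin n) (Fin n) ℂ) - T)
        (∑ i, ∑ j ∈ Finset.Icc 1 (r i), ((s - lam i) ^ j)⁻¹ • B i j) = 1) :
    (∀ i, ∀ j ∈ Finset.Icc 1 (r i), B i (j + 1) = T (B i j) - lam i • B i j) ∧
      ∑ i, B i 1 = 1 := by
  have := pf_unique lam hlam r (fun i j => B i (j + 1) - (T (B i j) - lam i • B i j))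
    (1 - ∑ i, B i 1) (by
      intro s hs
      rw [← hT s hs, map_sum, ← Finset.sum_sub_distrib]
      refine Finset.sum_congr rfl fun i _ => ?_
      have hx : s - lam i ≠ 0 := sub_ne_zero.2 (hs i)
      have h1 := shift_sum (fun j => ((s - lam i) ^ j)⁻¹ • B i (j + 1)) (r i)
      simp only [hB0 i (r i + 1) (by omega), smul_zero, sub_zero, pow_zero, inv_one, one_smul,
        zero_add] at h1
      rw [eq_sub_iff_add_eq, map_sum]
      simp only [smul_sub, Finset.sum_sub_distrib]
      have h2 : ∑ j ∈ Finset.Icc 1 (r i), (s • (LinearMap.id : Matrix (Fin n) (Fin n) ℂ →ₗ[ℂ] Matrix (Fin n) (Fin n) ℂ) - T)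
          (((s - lam i) ^ j)⁻¹ • B i j)
        = ∑ j ∈ Finset.Icc 1 (r i), ((s - lam i) ^ (j - 1))⁻¹ • B i (j - 1 + 1)
          - ∑ j ∈ Finset.Icc 1 (r i), (((s - lam i) ^ j)⁻¹ • T (B i j)
            - ((s - lam i) ^ j)⁻¹ • lam i • B i j) := by
        rw [← Finset.sum_sub_distrib]
        refine Finset.sum_congr rfl fun j hj => ?_
        obtain ⟨j, rfl⟩ := Nat.exists_eq_add_of_le' (Finset.mem_Icc.1 hj).1
        have h3 : ((s - lam i) ^ j)⁻¹ = (s - lam i) * ((s - lam i) ^ (j + 1))⁻¹ := by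
          field_simp
          ring
        simp only [Nat.add_sub_cancel, h3, LinearMap.sub_apply, LinearMap.smul_apply,
          LinearMap.id_apply, map_smul]
        module
      rw [h2, h1, Finset.sum_sub_distrib]
      abel)
  exact ⟨fun i j hj => sub_eq_zero.1 (this.1 i j hj), (sub_eq_zero.1 this.2).symm⟩

theorem core
    (n k : ℕ)
    (A : Matrix (Fin n) (Fin n) ℂ)
    (lam : Fin k → ℂ) (hlam : Function.Injective lam)
    (r : Fin k → ℕ) (hr : ∀ i, 1 ≤ r i)
    (hchar : A.charpoly = ∏ i, (X - C (lam i)) ^ r i)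
    (B : Fin k → ℕ → Matrix (Fin n) (Fin n) ℂ)
    (hB0 : ∀ i j, r i < j → B i j = 0)
    (hB : ∀ s : ℂ, (∀ i, s ≠ lam i) →
      (s • (1 : Matrix (Fin n) (Fin n) ℂ) - A)⁻¹
        = ∑ i, ∑ j ∈ Finset.Icc 1 (r i), ((s - lam i) ^ j)⁻¹ • B i j)
    (i : Fin k) (j : ℕ) (hj : 2 ≤ j) (hjr : j ≤ r i) : B i j = B i 2 ^ (j - 1) := by
  have hdet : ∀ s : ℂ, (∀ i, s ≠ lam i) →
      IsUnit (s • (1 : Matrix (Fin n) (Fin n) ℂ) - A).det := by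
    intro s hs
    have h1 := Matrix.eval_charpoly A s
    rw [hchar, eval_prod] at h1
    rw [smul_one_eq_diagonal, ← Matrix.scalar_apply, ← h1, isUnit_iff_ne_zero, Finset.prod_ne_zero_iff]
    intro l _
    simp only [eval_pow, eval_sub, eval_X, eval_C]
    exact pow_ne_zero _ (sub_ne_zero.2 (hs l))
  obtain ⟨hL, hone⟩ := coeff_rec lam hlam r B hB0 (LinearMap.mulLeft ℂ A) (by
    intro s hs
    have h1 := Matrix.mul_nonsing_inv _ (hdet s hs)
    rw [← hB s hs]
    simpa [sub_mul] using h1)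
  obtain ⟨hR, -⟩ := coeff_rec lam hlam r B hB0 (LinearMap.mulRight ℂ A) (by
    intro s hs
    have h1 := Matrix.nonsing_inv_mul _ (hdet s hs)
    rw [← hB s hs]
    simpa [mul_sub] using h1)
  simp only [LinearMap.mulLeft_apply, LinearMap.mulRight_apply] at hL hR
  let N : Fin k → Matrix (Fin n) (Fin n) ℂ := fun l => A - lam l • 1
  have hcomA : ∀ l, Commute A (B l 1) := by
    intro l
    have h1 : 1 ∈ Finset.Icc 1 (r l) := Finset.mem_Icc.2 ⟨le_rfl, hr l⟩
    have h2 := (hL l 1 h1).symm.trans (hR l 1 h1)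
    exact sub_left_injective h2
  have hcom : ∀ l m, Commute (N l) (B m 1) := fun l m =>
    (hcomA m).sub_left ((Commute.one_left _).smul_left _)
  have hpow : ∀ l m, m ≤ r l → B l (m + 1) = N l ^ m * B l 1 := by
    intro l m
    induction m with
    | zero => simp
    | succ m ih =>
      intro hm
      rw [hL l (m + 1) (Finset.mem_Icc.2 ⟨by omega, hm⟩), ih (by omega), pow_succ', mul_assoc]
      simp [N, sub_mul]
  have hkill : ∀ l, N l ^ r l * B l 1 = 0 := fun l => by
    rw [← hpow l _ le_rfl, hB0 l _ (by omega)]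
  have horth : ∀ l m, l ≠ m → B l 1 * B m 1 = 0 := by
    intro l m hlm
    have h1 : N l ^ r l * (B l 1 * B m 1) = 0 := by rw [← mul_assoc, hkill, zero_mul]
    have h2 : N m ^ r m * (B l 1 * B m 1) = 0 := by
      rw [← mul_assoc, ((hcom m l).pow_left _).eq, mul_assoc, hkill, mul_zero]
    have hcop : IsCoprime ((X - C (lam l)) ^ r l) ((X - C (lam m)) ^ r m) :=
      (isCoprime_X_sub_C_of_isUnit_sub
        (isUnit_iff_ne_zero.2 (sub_ne_zero.2 (hlam.ne hlm)))).pow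
    obtain ⟨u, v, huv⟩ := hcop
    have h3 := congrArg (aeval A) huv
    simp only [map_add, map_mul, map_pow, map_sub, aeval_X, aeval_C, map_one,
      Algebra.algebraMap_eq_smul_one] at h3
    calc B l 1 * B m 1 = 1 * (B l 1 * B m 1) := (one_mul _).symm
      _ = aeval A u * (N l ^ r l * (B l 1 * B m 1))
          + aeval A v * (N m ^ r m * (B l 1 * B m 1)) := by
        rw [← h3, add_mul, mul_assoc, mul_assoc]
      _ = 0 := by rw [h1, h2, mul_zero, mul_zero, add_zero]
  have hidem : IsIdempotentElem (B i 1) := by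
    have h1 : B i 1 * ∑ l, B l 1 = B i 1 := by rw [hone, mul_one]
    rw [Finset.mul_sum, Finset.sum_eq_single i (fun l _ hl => horth i l hl.symm) (by simp)] at h1
    exact h1
  obtain ⟨m, rfl⟩ := Nat.exists_eq_add_of_le' hj
  have h2 : B i 2 = N i * B i 1 := by simpa using hpow i 1 (hr i)
  rw [h2, (hcom i i).mul_pow, show m + 2 - 1 = m + 1 by omega, hidem.pow_succ_eq]
  exact hpow i (m + 1) (by omega)

/-- `B i j = (B i 2)^(j-1)` for `2 ≤ j ≤ r i`. -/
theorem coefficient_nilpotent_power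
    (n k : ℕ) (hn : 1 ≤ n)
    (A : Matrix (Fin n) (Fin n) ℂ)
    (lam : Fin k → ℂ) (hlam : Function.Injective lam)
    (r : Fin k → ℕ) (hr : ∀ i, 1 ≤ r i)
    (hsum : ∑ i, r i = n)
    (hchar : A.charpoly = ∏ i, (X - C (lam i)) ^ r i)
    (B : Fin k → ℕ → Matrix (Fin n) (Fin n) ℂ)
    (hB : ∀ s : ℂ, (∀ i, s ≠ lam i) →
      (s • (1 : Matrix (Fin n) (Fin n) ℂ) - A)⁻¹
        = ∑ i, ∑ j ∈ Finset.Icc 1 (r i), ((s - lam i) ^ j)⁻¹ • B i j)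
    :
    ∀ i : Fin k, ∀ j : ℕ, 2 ≤ j → j ≤ r i → B i j = B i 2 ^ (j - 1) := by
  intro i j hj hjr
  have := core n k A lam hlam r hr hchar (fun i j => if j ≤ r i then B i j else 0)
    (fun i j h => if_neg (by omega)) (by
      intro s hs
      rw [hB s hs]
      refine Finset.sum_congr rfl fun l _ => Finset.sum_congr rfl fun m hm => ?_
      rw [if_pos (Finset.mem_Icc.1 hm).2]) i j hj hjr
  simpa only [if_pos hjr, if_pos (hj.trans hjr)] using this
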